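/- For every d ≥ 1, the set of continuous maps f ∈ C([0,1]^d, ℝ^d) such that for every x ∈ [0,1]^d, limsup_{r→0⁺} λ^d(f(B(x,r) ∩ [0,1]^d)) / λ^d(B(x,r)) = ∞, is comeager in C([0,1]^d, ℝ^d) with the uniform metric. -/

import Mathlib

open MeasureTheory Metric Set Filter Topology

/-- The unit cube `[0,1]^d` in Euclidean space. -/
def cube (d : ℕ) : Set (EuclideanSpace ℝ (Fin d)) := {x | ∀ i, x i ∈ Icc (0 : ℝ) 1}

theorem aux_det_interp {d : ℕ} (v : ℕ → ℝ) (hv : Function.Injective v)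
    (A : EuclideanSpace ℝ (Fin d) →L[ℝ] EuclideanSpace ℝ (Fin d)) (t : ℝ) :
    (ContinuousLinearMap.id ℝ _ + t • A).det =
      ∑ i ∈ Finset.range (d + 1), (Lagrange.basis (Finset.range (d + 1)) v i).eval t *
        (ContinuousLinearMap.id ℝ _ + (v i) • A).det := by
  classical
  set b := (EuclideanSpace.basisFun (Fin d) ℝ).toBasis
  set M := LinearMap.toMatrix b b (A : EuclideanSpace ℝ (Fin d) →ₗ[ℝ] EuclideanSpace ℝ (Fin d)) with hM
  set P : Polynomial ℝ := Matrix.det ((Polynomial.X : Polynomial ℝ) • M.map Polynomial.C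
    + (1 : Matrix (Fin d) (Fin d) ℝ).map Polynomial.C) with hP
  have hdet : ∀ s : ℝ, (ContinuousLinearMap.id ℝ (EuclideanSpace ℝ (Fin d)) + s • A).det = P.eval s := by
    intro s
    rw [ContinuousLinearMap.det, ← LinearMap.det_toMatrix b, hP, ← Polynomial.coe_evalRingHom,
      RingHom.map_det]
    congr 1
    have : LinearMap.toMatrix b b ((ContinuousLinearMap.id ℝ (EuclideanSpace ℝ (Fin d)) + s • A :
      EuclideanSpace ℝ (Fin d) →L[ℝ] EuclideanSpace ℝ (Fin d)) : EuclideanSpace ℝ (Fin d) →ₗ[ℝ] EuclideanSpace ℝ (Fin d)) = 1 + s • M := by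
      rw [hM, ← LinearMap.toMatrix_id b, ← map_smul, ← map_add]
      rfl
    rw [this]
    ext i j
    clear_value M
    by_cases hij : i = j
    · subst hij; simp; ring
    · simp [hij]; ring
  have hdeg : P.degree < (Finset.range (d + 1)).card := by
    have := Polynomial.natDegree_det_X_add_C_le M 1
    refine lt_of_le_of_lt Polynomial.degree_le_natDegree ?_
    simp only [Fintype.card_fin] at this
    rw [Finset.card_range]
    exact_mod_cast Nat.lt_succ_of_le this
  have := Lagrange.eq_interpolate (v := v) (hv.injOn) hdeg
  simp_rw [hdet]
  conv_lhs => rw [this, Lagrange.interpolate_apply, Polynomial.eval_finsetSum]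
  refine Finset.sum_congr rfl fun i _ => ?_
  simp [mul_comm]

theorem aux_det_pos {d : ℕ} (A : EuclideanSpace ℝ (Fin d) →L[ℝ] EuclideanSpace ℝ (Fin d))
    (t C : ℝ) (ht : 0 ≤ t) (hA : ‖A‖ ≤ C) (htC : t * C < 1) :
    0 < (ContinuousLinearMap.id ℝ _ + t • A).det := by
  by_contra hneg
  push Not at hneg
  have hcont : Continuous fun s : ℝ =>
      (ContinuousLinearMap.id ℝ (EuclideanSpace ℝ (Fin d)) + s • A).det :=
    ContinuousLinearMap.continuous_det.comp (by fun_prop)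
  have h0 : (ContinuousLinearMap.id ℝ (EuclideanSpace ℝ (Fin d)) + (0:ℝ) • A).det = 1 := by
    simp [ContinuousLinearMap.det]
  obtain ⟨s, hs, hs0⟩ := intermediate_value_Icc' ht hcont.continuousOn
    (show (0:ℝ) ∈ Icc _ _ from ⟨hneg, by rw [h0]; exact zero_le_one⟩)
  have := LinearMap.bot_lt_ker_of_det_eq_zero (f := ((ContinuousLinearMap.id ℝ (EuclideanSpace ℝ (Fin d)) + s • A :
      EuclideanSpace ℝ (Fin d) →L[ℝ] EuclideanSpace ℝ (Fin d)) : EuclideanSpace ℝ (Fin d) →ₗ[ℝ] EuclideanSpace ℝ (Fin d))) hs0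
  obtain ⟨v, hv, hv0⟩ := Submodule.exists_mem_ne_zero_of_ne_bot this.ne'
  have hv' : v + s • A v = 0 := by simpa using hv
  have h1 : ‖v‖ = s * ‖A v‖ := by
    conv_lhs => rw [eq_neg_of_add_eq_zero_left hv', norm_neg, norm_smul, Real.norm_of_nonneg hs.1]
  have h2 : ‖A v‖ ≤ C * ‖v‖ := (A.le_opNorm v).trans (by gcongr)
  have h3 : 0 < ‖v‖ := norm_pos_iff.2 hv0
  have hC : 0 ≤ C := (norm_nonneg A).trans hA
  have h4 : s * ‖A v‖ ≤ t * (C * ‖v‖) := mul_le_mul hs.2 h2 (norm_nonneg _) ht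
  nlinarith

/-- Perturbation of the identity by a small Lipschitz map vanishing on the sphere is bijective
on the ball. -/
theorem aux_bij {d : ℕ} (h : EuclideanSpace ℝ (Fin d) → EuclideanSpace ℝ (Fin d)) (C : NNReal)
    (hL : LipschitzOnWith C h (closedBall 0 1)) (h0 : ∀ x, ‖x‖ = 1 → h x = 0)
    (t : ℝ) (ht : 0 ≤ t) (htC : t * (2 * C) < 1) :
    InjOn (fun x => x + t • h x) (closedBall 0 1) ∧
      (fun x => x + t • h x) '' closedBall 0 1 = closedBall 0 1 := by
  classical
  set H : EuclideanSpace ℝ (Fin d) → EuclideanSpace ℝ (Fin d) :=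
    fun x => if ‖x‖ ≤ 1 then h x else 0 with hH
  have key : ∀ x y, ‖x‖ ≤ 1 → ¬ ‖y‖ ≤ 1 → ‖h x‖ ≤ 2 * C * ‖x - y‖ := by
    intro x y hx hy
    push Not at hy
    have hz : ‖(‖y‖⁻¹ • y)‖ = 1 := by
      rw [norm_smul, norm_inv, norm_norm, inv_mul_cancel₀ (by positivity)]
    have h1 := hL.norm_sub_le (show x ∈ closedBall 0 1 by simpa using hx)
      (show (‖y‖⁻¹ • y) ∈ closedBall 0 1 by simpa using hz.le)
    rw [h0 _ hz, sub_zero] at h1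
    have h2 : ‖y - ‖y‖⁻¹ • y‖ = ‖y‖ - 1 := by
      have : y - ‖y‖⁻¹ • y = (1 - ‖y‖⁻¹) • y := by rw [sub_smul, one_smul]
      rw [this, norm_smul, Real.norm_of_nonneg (sub_nonneg.2 (inv_le_one_of_one_le₀ hy.le)), sub_mul,
        inv_mul_cancel₀ (by positivity), one_mul]
    have h3 : ‖y‖ - ‖x‖ ≤ ‖x - y‖ := by
      rw [norm_sub_rev]; exact norm_sub_norm_le y x
    have h4 : ‖x - ‖y‖⁻¹ • y‖ ≤ ‖x - y‖ + ‖y - ‖y‖⁻¹ • y‖ := norm_sub_le_norm_sub_add_norm_sub _ _ _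
    calc ‖h x‖ ≤ C * ‖x - ‖y‖⁻¹ • y‖ := h1
      _ ≤ C * (2 * ‖x - y‖) := by gcongr; linarith
      _ = _ := by ring
  have HL : ∀ x y, ‖H x - H y‖ ≤ 2 * C * ‖x - y‖ := by
    intro x y
    by_cases hx : ‖x‖ ≤ 1 <;> by_cases hy : ‖y‖ ≤ 1
    · simp only [hH, hx, hy, if_true]
      refine (hL.norm_sub_le (by simpa using hx) (by simpa using hy)).trans ?_
      have : 0 ≤ (C:ℝ) * ‖x - y‖ := by positivity
      linarith
    · simp only [hH, hx, hy, if_true, if_false, sub_zero]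
      exact key x y hx hy
    · simp only [hH, hx, hy, if_true, if_false, zero_sub, norm_neg]
      rw [norm_sub_rev]
      exact key y x hy hx
    · simp only [hH, hx, hy, if_false, sub_zero, norm_zero]
      positivity
  have HB : ∀ x, ‖x‖ ≤ 1 → H x = h x := fun x hx => by simp [hH, hx]
  have hinj : ∀ x y, x + t • H x = y + t • H y → x = y := by
    intro x y hxy
    have h1 : x - y = t • (H y - H x) := by
      rw [smul_sub, sub_eq_sub_iff_add_eq_add, hxy, add_comm]
    have h2 : ‖x - y‖ ≤ t * (2 * C * ‖x - y‖) := by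
      conv_lhs => rw [h1, norm_smul, Real.norm_of_nonneg ht, norm_sub_rev]
      exact mul_le_mul_of_nonneg_left (HL x y) ht
    by_contra hne
    have h3 : 0 < ‖x - y‖ := norm_pos_iff.2 (sub_ne_zero.2 hne)
    nlinarith
  have hsurj : ∀ y, ∃ x, x + t • H x = y := by
    intro y
    have hc : ContractingWith (Real.toNNReal (t * (2 * C))) (fun x => y - t • H x) := by
      refine ⟨by simpa [Real.toNNReal_lt_one] using htC, LipschitzWith.of_dist_le_mul fun a b => ?_⟩
      rw [Real.coe_toNNReal _ (by positivity), dist_eq_norm, dist_eq_norm, sub_sub_sub_cancel_left, ← smul_sub,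
        norm_smul, Real.norm_of_nonneg ht, norm_sub_rev, mul_assoc]
      exact mul_le_mul_of_nonneg_left (HL a b) ht
    refine ⟨hc.fixedPoint, ?_⟩
    have := hc.fixedPoint_isFixedPt
    have h1 : y - t • H (hc.fixedPoint) = hc.fixedPoint := this
    exact (sub_eq_iff_eq_add.1 h1).symm
  refine ⟨?_, ?_⟩
  · intro x hx y hy hxy
    simp only [mem_closedBall, dist_zero_right] at hx hy
    apply hinj
    rw [HB x hx, HB y hy]; exact hxy
  · apply Subset.antisymm
    · rintro _ ⟨x, hx, rfl⟩
      simp only [mem_closedBall, dist_zero_right] at hx ⊢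
      by_contra hy
      have h1 : H (x + t • h x) = 0 := by simp only [hH, hy, if_false]
      have : x = x + t • h x := by
        apply hinj
        rw [h1, HB x hx]; simp
      rw [← this] at hy
      exact hy hx
    · intro y hy
      obtain ⟨x, hx⟩ := hsurj y
      simp only [mem_closedBall, dist_zero_right] at hy
      have hxb : ‖x‖ ≤ 1 := by
        by_contra hxb
        have : H x = 0 := by simp only [hH, hxb, if_false]
        rw [this] at hx
        simp only [smul_zero, add_zero] at hx
        exact hxb (hx ▸ hy)
      exact ⟨x, by simpa using hxb, by rw [← hx, HB x hxb]⟩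

/-- There is no `C¹` retraction onto the sphere, in the form used here. -/
theorem aux_no_retraction {d : ℕ} (r : EuclideanSpace ℝ (Fin d) → EuclideanSpace ℝ (Fin d))
    (hr : ContDiff ℝ 1 r) (hn : ∀ x, ‖r x‖ = 1) (hS : ∀ x, ‖x‖ = 1 → r x = x) : False := by
  set h : EuclideanSpace ℝ (Fin d) → EuclideanSpace ℝ (Fin d) := fun x => r x - x with hh
  have hC1 : ContDiff ℝ 1 h := hr.sub contDiff_id
  have hD : Continuous (fderiv ℝ h) := hC1.continuous_fderiv one_ne_zero
  have hdiff : ∀ x, HasFDerivAt h (fderiv ℝ h x) x := fun x =>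
    (hC1.differentiable one_ne_zero x).hasFDerivAt
  obtain ⟨C0, hC0⟩ := (isCompact_closedBall (0 : EuclideanSpace ℝ (Fin d)) 1).exists_bound_of_continuousOn
    hD.continuousOn
  set C : NNReal := Real.toNNReal C0 with hCdef
  have hC : ∀ x ∈ closedBall (0 : EuclideanSpace ℝ (Fin d)) 1, ‖fderiv ℝ h x‖ ≤ C := fun x hx =>
    (hC0 x hx).trans (Real.le_coe_toNNReal C0)
  have hL : LipschitzOnWith C h (closedBall 0 1) :=
    (convex_closedBall _ _).lipschitzOnWith_of_nnnorm_hasFDerivWithin_le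
      (fun x _ => (hdiff x).hasFDerivWithinAt) (fun x hx => by exact_mod_cast hC x hx)
  have h0 : ∀ x, ‖x‖ = 1 → h x = 0 := fun x hx => by simp [hh, hS x hx]
  have hcd : ∀ t : ℝ, Continuous fun x =>
      (ContinuousLinearMap.id ℝ (EuclideanSpace ℝ (Fin d)) + t • fderiv ℝ h x).det := fun t =>
    ContinuousLinearMap.continuous_det.comp (by fun_prop)
  have hint : ∀ t : ℝ, IntegrableOn (fun x =>
      (ContinuousLinearMap.id ℝ (EuclideanSpace ℝ (Fin d)) + t • fderiv ℝ h x).det)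
      (closedBall 0 1) volume := fun t =>
    (hcd t).continuousOn.integrableOn_compact (isCompact_closedBall _ _)
  have hsmall : ∀ t : ℝ, 0 ≤ t → t * (2 * C) < 1 →
      ∫ x in closedBall 0 1, (ContinuousLinearMap.id ℝ (EuclideanSpace ℝ (Fin d)) + t • fderiv ℝ h x).det
        = volume.real (closedBall (0 : EuclideanSpace ℝ (Fin d)) 1) := by
    intro t ht htC
    obtain ⟨hi, him⟩ := aux_bij h C hL h0 t ht htC
    have := integral_image_eq_integral_abs_det_fderiv_smul volume
      (isClosed_closedBall.measurableSet)
      (f' := fun x => ContinuousLinearMap.id ℝ (EuclideanSpace ℝ (Fin d)) + t • fderiv ℝ h x)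
      (fun x _ => ((hasFDerivAt_id x).add ((hdiff x).const_smul t)).hasFDerivWithinAt) hi
      (fun _ => (1 : ℝ))
    simp only [smul_eq_mul, mul_one] at this
    rw [setIntegral_const, smul_eq_mul, mul_one] at this
    erw [him] at this
    rw [this]
    refine setIntegral_congr_fun isClosed_closedBall.measurableSet fun x hx => ?_
    refine (abs_of_pos (aux_det_pos _ t C ht (hC x hx) ?_)).symm
    have : 0 ≤ t * C := by positivity
    linarith
  -- nodes
  set v : ℕ → ℝ := fun i => 1 / ((2 * C + 1) * (i + 1)) with hv
  have hvinj : Function.Injective v := by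
    intro i j hij
    simp only [hv, one_div, inv_inj] at hij
    have h1 : (2 * (C:ℝ) + 1) ≠ 0 := by positivity
    have := mul_left_cancel₀ h1 hij
    exact_mod_cast add_right_cancel this
  have hv0 : ∀ i, 0 ≤ v i := fun i => by simp only [hv]; positivity
  have hv1 : ∀ i, v i * (2 * C) < 1 := by
    intro i
    simp only [hv]
    rw [div_mul_eq_mul_div, one_mul, div_lt_one (by positivity)]
    have : 0 ≤ (2 * (C:ℝ) + 1) * i := by positivity
    nlinarith
  have hone : ∫ x in closedBall 0 1, (ContinuousLinearMap.id ℝ (EuclideanSpace ℝ (Fin d)) + (1:ℝ) • fderiv ℝ h x).det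
        = volume.real (closedBall (0 : EuclideanSpace ℝ (Fin d)) 1) := by
    simp_rw [aux_det_interp v hvinj _ 1]
    rw [integral_finsetSum _ (fun i _ => (hint (v i)).const_mul _)]
    simp_rw [integral_const_mul, hsmall _ (hv0 _) (hv1 _)]
    rw [← Finset.sum_mul, ← Polynomial.eval_finsetSum, Lagrange.sum_basis hvinj.injOn (by simp)]
    simp
  have hzero : ∀ x, (ContinuousLinearMap.id ℝ (EuclideanSpace ℝ (Fin d)) + (1:ℝ) • fderiv ℝ h x).det = 0 := by
    intro x
    by_contra hne
    have hrd : HasFDerivAt r (ContinuousLinearMap.id ℝ (EuclideanSpace ℝ (Fin d)) + (1:ℝ) • fderiv ℝ h x) x := by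
      have := (hasFDerivAt_id x).add ((hdiff x).const_smul (1:ℝ))
      refine this.congr_of_eventuallyEq (Eventually.of_forall fun y => ?_)
      simp [hh]
    set L := ContinuousLinearMap.id ℝ (EuclideanSpace ℝ (Fin d)) + (1:ℝ) • fderiv ℝ h x with hLdef
    have hsq : HasFDerivAt (fun y => inner ℝ (r y) (r y)) _ x := hrd.inner ℝ hrd
    have hconst : (fun y => inner ℝ (r y) (r y)) = fun _ => (1:ℝ) := by
      funext y; rw [real_inner_self_eq_norm_sq, hn]; norm_num
    rw [hconst] at hsq
    have huniq := hsq.unique (hasFDerivAt_const (1:ℝ) x)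
    have hsurj : Function.Surjective L := by
      have hu : IsUnit (LinearMap.det (L : EuclideanSpace ℝ (Fin d) →ₗ[ℝ] EuclideanSpace ℝ (Fin d))) :=
        isUnit_iff_ne_zero.2 hne
      have := (LinearMap.equivOfDetNeZero (L : EuclideanSpace ℝ (Fin d) →ₗ[ℝ] EuclideanSpace ℝ (Fin d)) hne).surjective
      exact this
    obtain ⟨w, hw⟩ := hsurj (r x)
    have h2 := congrArg (fun T => T w) huniq
    simp [hw, hn] at h2
  simp_rw [hzero] at hone
  rw [integral_zero] at hone
  have hpos : 0 < volume.real (closedBall (0 : EuclideanSpace ℝ (Fin d)) 1) :=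
    ENNReal.toReal_pos (measure_closedBall_pos _ _ one_pos).ne' measure_closedBall_lt_top.ne
  exact hpos.ne hone

theorem aux_core {d : ℕ} (H : EuclideanSpace ℝ (Fin d) → EuclideanSpace ℝ (Fin d))
    (hH : ContDiff ℝ 1 H) (h0 : ∀ x, 1 ≤ ‖x‖ → H x = 0) : ∃ x, x + H x = 0 := by
  by_contra hne
  push Not at hne
  have hk : ContDiff ℝ 1 (fun x => x + H x) := contDiff_id.add hH
  refine aux_no_retraction (fun x => ‖x + H x‖⁻¹ • (x + H x)) ?_ ?_ ?_
  · exact ((hk.norm ℝ hne).inv fun x => norm_ne_zero_iff.2 (hne x)).smul hk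
  · intro x
    rw [norm_smul, norm_inv, norm_norm, inv_mul_cancel₀ (norm_ne_zero_iff.2 (hne x))]
  · intro x hx
    simp [h0 x hx.ge, hx]

theorem aux_smooth {d : ℕ} (G : EuclideanSpace ℝ (Fin d) → EuclideanSpace ℝ (Fin d))
    (hG : ContDiff ℝ 1 G) (hc : ∀ x ∈ closedBall (0 : EuclideanSpace ℝ (Fin d)) 1, ‖G x - x‖ ≤ 3 / 4) :
    ∃ x ∈ closedBall (0 : EuclideanSpace ℝ (Fin d)) 1, G x = 0 := by
  let b : ContDiffBump (0 : EuclideanSpace ℝ (Fin d)) := ⟨4/5, 1, by norm_num, by norm_num⟩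
  obtain ⟨x, hx⟩ := aux_core (fun x => b x • (G x - x)) (b.contDiff.smul (hG.sub contDiff_id)) (by
    intro x hx
    rw [b.zero_of_le_dist (by simpa using hx), zero_smul])
  have hx1 : ‖x‖ ≤ 1 := by
    by_contra hcon
    push Not at hcon
    rw [b.zero_of_le_dist (by simpa using hcon.le), zero_smul, add_zero] at hx
    rw [hx, norm_zero] at hcon
    linarith
  have hxm : x ∈ closedBall (0 : EuclideanSpace ℝ (Fin d)) 1 := by simpa using hx1
  refine ⟨x, hxm, ?_⟩
  have h1 : ‖x‖ ≤ 3 / 4 := by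
    have e1 : ‖x‖ = b x * ‖G x - x‖ := by
      conv_lhs => rw [eq_neg_of_add_eq_zero_left hx, norm_neg, norm_smul, Real.norm_of_nonneg b.nonneg]
    rw [e1]
    calc b x * ‖G x - x‖ ≤ 1 * (3 / 4) :=
          mul_le_mul b.le_one (hc x hxm) (norm_nonneg _) zero_le_one
      _ = 3 / 4 := one_mul _
  have h2 : b x = 1 := b.one_of_mem_closedBall (by
    simp only [mem_closedBall, dist_zero_right]
    exact h1.trans (show (3/4:ℝ) ≤ 4/5 by norm_num))
  rw [h2, one_smul] at hx
  simpa using hx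

theorem aux_cover {d : ℕ} (F : EuclideanSpace ℝ (Fin d) → EuclideanSpace ℝ (Fin d))
    (hF : Continuous F) (hc : ∀ x ∈ closedBall (0 : EuclideanSpace ℝ (Fin d)) 1, ‖F x - x‖ ≤ 1 / 4) :
    closedBall 0 (1 / 4) ⊆ F '' closedBall 0 1 := by
  intro p hp
  have hcl : IsClosed (F '' closedBall 0 1) :=
    ((isCompact_closedBall _ _).image hF).isClosed
  rw [← hcl.closure_eq, Metric.mem_closure_iff]
  intro ε hε
  obtain ⟨g, hg, hgF⟩ := hF.exists_contDiff_approx 1 (ε := fun _ => min ε (1/4)) continuous_const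
    (fun _ => by positivity)
  simp only [mem_closedBall, dist_zero_right] at hp
  obtain ⟨x, hx, hx0⟩ := aux_smooth (fun x => g x - p) (hg.sub contDiff_const) (by
    intro x hx
    have h1 := hc x hx
    have h2 := (hgF.1 x).trans_le (min_le_right _ _)
    rw [dist_eq_norm] at h2
    calc ‖g x - p - x‖ = ‖(g x - F x) + (F x - x) - p‖ := by congr 1; abel
      _ ≤ ‖(g x - F x) + (F x - x)‖ + ‖p‖ := norm_sub_le _ _
      _ ≤ ‖g x - F x‖ + ‖F x - x‖ + ‖p‖ := by gcongr; exact norm_add_le _ _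
      _ ≤ 3 / 4 := by linarith)
  refine ⟨F x, ⟨x, hx, rfl⟩, ?_⟩
  rw [← sub_eq_zero.1 hx0]
  exact (hgF.1 x).trans_le (min_le_left _ _)

theorem aux_local {d : ℕ} (f : C(↥(cube d), EuclideanSpace ℝ (Fin d)))
    (c q : EuclideanSpace ℝ (Fin d)) (s a : ℝ) (hs : 0 < s) (ha : 0 < a)
    (hsub : closedBall c s ⊆ cube d)
    (hf : ∀ y : ↥(cube d), (y : EuclideanSpace ℝ (Fin d)) ∈ closedBall c s →
      ‖f y - (q + (a / s) • ((y : EuclideanSpace ℝ (Fin d)) - c))‖ ≤ a / 4) :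
    closedBall q (a / 4) ⊆ f '' ((↑) ⁻¹' closedBall c s) := by
  let P : EuclideanSpace ℝ (Fin d) → ↥(cube d) := fun x =>
    ⟨WithLp.toLp 2 (fun i => max 0 (min 1 (x i))), fun i => ⟨by simp, by simp⟩⟩
  have hP : Continuous P := by
    refine Continuous.subtype_mk ?_ _
    fun_prop
  have hPid : ∀ x (hx : x ∈ cube d), P x = ⟨x, hx⟩ := by
    intro x hx
    apply Subtype.ext
    ext i
    have := hx i
    simp [P, this.1, this.2]
  have hmem : ∀ u ∈ closedBall (0 : EuclideanSpace ℝ (Fin d)) 1, c + s • u ∈ closedBall c s := by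
    intro u hu
    simp only [mem_closedBall, dist_zero_right] at hu
    rw [mem_closedBall, dist_eq_norm, add_sub_cancel_left, norm_smul, Real.norm_of_nonneg hs.le]
    nlinarith
  have := aux_cover (fun u => a⁻¹ • (f (P (c + s • u)) - q)) (by fun_prop) (by
    intro u hu
    have h1 := hmem u hu
    have h2 := hf ⟨_, hsub h1⟩ h1
    simp only [hPid _ (hsub h1)]
    have e : a⁻¹ • (f ⟨_, hsub h1⟩ - q) - u =
        a⁻¹ • (f ⟨_, hsub h1⟩ - (q + (a / s) • ((c + s • u) - c))) := by
      rw [add_sub_cancel_left, smul_smul, div_mul_cancel₀ _ hs.ne', ← sub_sub, smul_sub _ (f _ - q),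
        smul_smul, inv_mul_cancel₀ ha.ne', one_smul]
    rw [e, norm_smul, norm_inv, Real.norm_of_nonneg ha.le, inv_mul_le_iff₀ ha]
    linarith)
  intro p hp
  obtain ⟨u, hu, hup⟩ := this (show a⁻¹ • (p - q) ∈ closedBall 0 (1/4) by
    rw [mem_closedBall, dist_zero_right, norm_smul, norm_inv, Real.norm_of_nonneg ha.le,
      inv_mul_le_iff₀ ha, ← dist_eq_norm]
    have := mem_closedBall.1 hp
    linarith)
  refine ⟨P (c + s • u), ?_, ?_⟩
  · rw [hPid _ (hsub (hmem u hu))]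
    exact hmem u hu
  · have := smul_right_injective _ (inv_ne_zero ha.ne') hup
    exact sub_left_injective this

theorem aux_norm_le {d : ℕ} (x : EuclideanSpace ℝ (Fin d)) (B : ℝ) (hB : 0 ≤ B)
    (h : ∀ i, |x i| ≤ B) : ‖x‖ ≤ d * B := by
  rw [EuclideanSpace.norm_eq, Real.sqrt_le_iff]
  refine ⟨by positivity, ?_⟩
  calc ∑ i, ‖x i‖ ^ 2 ≤ ∑ _i : Fin d, B ^ 2 := by
        gcongr with i _
        exact h i
    _ = d * B ^ 2 := by simp
    _ ≤ (d * B) ^ 2 := by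
        have : (d : ℝ) ≤ (d : ℝ) ^ 2 := by exact_mod_cast Nat.le_self_pow two_ne_zero d
        rw [mul_pow]; gcongr

theorem aux_center (s x : ℝ) (hs : 0 < s) (hs1 : s ≤ 1 / 28) (hx : x ∈ Icc (0:ℝ) 1) :
    ∃ k : ℤ, s ≤ 2 * Real.pi * s * k ∧ 2 * Real.pi * s * k ≤ 1 - s ∧
      |2 * Real.pi * s * k - x| ≤ 13 * s := by
  have hp3 := Real.pi_gt_three
  have hp4 := Real.pi_lt_d2
  have hm : 0 < 2 * Real.pi * s := by positivity
  have ha : 6 * s ≤ 2 * Real.pi * s := by nlinarith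
  have hb : 2 * Real.pi * s ≤ 6.3 * s := by nlinarith
  have h1 := Int.floor_le (x / (2 * Real.pi * s))
  have h2 := Int.lt_floor_add_one (x / (2 * Real.pi * s))
  rw [le_div_iff₀ hm] at h1
  rw [div_lt_iff₀ hm] at h2
  have h3 : (0:ℝ) ≤ ⌊x / (2 * Real.pi * s)⌋ := by
    exact_mod_cast Int.floor_nonneg.2 (div_nonneg hx.1 hm.le)
  set k := ⌊x / (2 * Real.pi * s)⌋
  set m := 2 * Real.pi * s
  have h4 : 0 ≤ (k : ℝ) * m := by positivity
  have h5 : ((k : ℝ) + 1) * m = k * m + m := by ring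
  rw [h5] at h2
  by_cases hx2 : x ≤ 1 / 2
  · refine ⟨k + 1, ?_⟩
    have e : m * ((k + 1 : ℤ) : ℝ) = k * m + m := by push_cast; ring
    rw [e]
    refine ⟨by linarith, by linarith, ?_⟩
    rw [abs_le]; constructor <;> linarith
  · refine ⟨k - 1, ?_⟩
    have e : m * ((k - 1 : ℤ) : ℝ) = k * m - m := by push_cast; ring
    rw [e]
    push Not at hx2
    have := hx.2
    refine ⟨by linarith, by linarith, ?_⟩
    rw [abs_le]; constructor <;> linarith

theorem aux_compact (d : ℕ) : CompactSpace ↥(cube d) := by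
  rw [← isCompact_iff_compactSpace]
  refine Metric.isCompact_of_isClosed_isBounded ?_ ?_
  · have : cube d = ⋂ i, {x : EuclideanSpace ℝ (Fin d) | x i ∈ Icc (0:ℝ) 1} := by
      ext x; simp [cube]
    rw [this]
    exact isClosed_iInter fun i => isClosed_Icc.preimage (by fun_prop)
  · refine (Metric.isBounded_iff_subset_closedBall 0).2 ⟨d * 1, fun x hx => ?_⟩
    rw [mem_closedBall, dist_zero_right]
    exact aux_norm_le x 1 zero_le_one fun i => abs_le.2 ⟨by linarith [(hx i).1], (hx i).2⟩

theorem aux_residual (d : ℕ) (hd : 1 ≤ d) (n : ℕ) :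
    {f : C(↥(cube d), EuclideanSpace ℝ (Fin d)) | ∀ x : ↥(cube d), ∃ r : ℝ, 0 < r ∧ r < 1 / (n + 1) ∧
      (n : ENNReal) * volume (closedBall (x : EuclideanSpace ℝ (Fin d)) r) ≤
        volume (f '' ((↑) ⁻¹' closedBall (x : EuclideanSpace ℝ (Fin d)) r))} ∈
      residual C(↥(cube d), EuclideanSpace ℝ (Fin d)) := by
  have := aux_compact d
  refine mem_of_superset (residual_of_dense_open isOpen_interior ?_) interior_subset
  rw [Metric.dense_iff]
  intro f₀ ε hε
  have hd0 : (1:ℝ) ≤ d := by exact_mod_cast hd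
  set a : ℝ := ε / (4 * d) with ha_def
  have ha : 0 < a := by positivity
  obtain ⟨δ, hδ, hδf⟩ := Metric.uniformContinuous_iff.1
    (CompactSpace.uniformContinuous_of_continuous f₀.continuous) (a / 8) (by positivity)
  obtain ⟨s, hs, hs1, hs2, hs3, hs4⟩ : ∃ s : ℝ, 0 < s ∧ s ≤ 1 / 28 ∧ s < δ ∧
      14 * d * s * (n + 1) ≤ a / 4 ∧ 14 * d * s < 1 / (n + 1) := by
    refine ⟨min (min (1/28) (δ/2)) (min (a / (56 * d * (n + 1))) (1 / (28 * d * (n+1)))),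
      by positivity, ?_, ?_, ?_, ?_⟩
    · exact (min_le_left _ _).trans (min_le_left _ _)
    · exact ((min_le_left _ _).trans (min_le_right _ _)).trans_lt (by linarith)
    · calc _ ≤ 14 * d * (a / (56 * d * (n + 1))) * (n + 1) := by
            gcongr; exact (min_le_right _ _).trans (min_le_left _ _)
        _ = a / 4 := by field_simp; norm_num
    · calc _ ≤ (14:ℝ) * d * (1 / (28 * d * (n + 1))) := by
            gcongr; exact (min_le_right _ _).trans (min_le_right _ _)
        _ = (1 / 2) * (1 / (n + 1)) := by field_simp; norm_num
        _ < 1 / (n + 1) := by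
            have : (0:ℝ) < 1 / (n + 1) := by positivity
            linarith
  let w : C(↥(cube d), EuclideanSpace ℝ (Fin d)) :=
    ⟨fun y => WithLp.toLp 2 (fun i => a * Real.arcsin (Real.sin ((y : EuclideanSpace ℝ (Fin d)) i / s))),
      by
        have := Real.continuous_arcsin
        fun_prop⟩
  have hwn : ∀ y, ‖w y‖ ≤ ε / 2 := by
    intro y
    have := aux_norm_le (w y) (a * 2) (by positivity) (by
      intro i
      change |a * Real.arcsin _| ≤ a * 2
      rw [abs_mul, abs_of_pos ha]
      gcongr
      have h1 := Real.neg_pi_div_two_le_arcsin (Real.sin ((y : EuclideanSpace ℝ (Fin d)) i / s))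
      have h2 := Real.arcsin_le_pi_div_two (Real.sin ((y : EuclideanSpace ℝ (Fin d)) i / s))
      have := Real.pi_lt_four
      rw [abs_le]; constructor <;> linarith)
    refine this.trans (le_of_eq ?_)
    rw [ha_def]; field_simp; norm_num
  refine ⟨f₀ + w, ?_, ?_⟩
  · rw [mem_ball, dist_eq_norm, add_sub_cancel_left]
    exact ((ContinuousMap.norm_le _ (by positivity)).2 hwn).trans_lt (by linarith)
  rw [mem_interior_iff_mem_nhds, Metric.mem_nhds_iff]
  refine ⟨a / 8, by positivity, fun f hf x => ?_⟩
  refine ⟨14 * d * s, by positivity, hs4, ?_⟩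
  choose k hk1 hk2 hk3 using fun i => aux_center s ((x : EuclideanSpace ℝ (Fin d)) i) hs hs1 (x.2 i)
  set c : EuclideanSpace ℝ (Fin d) := WithLp.toLp 2 (fun i => 2 * Real.pi * s * k i) with hc
  have hci : ∀ i, c i = 2 * Real.pi * s * k i := fun i => rfl
  have hcoord : ∀ y ∈ closedBall c s, ∀ i, |y i - c i| ≤ s := by
    intro y hy i
    rw [mem_closedBall, dist_eq_norm] at hy
    exact (PiLp.norm_apply_le (y - c) i).trans hy
  have hsub : closedBall c s ⊆ cube d := by
    intro y hy i
    have h1 := abs_le.1 (hcoord y hy i)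
    have h2 := hk1 i
    have h3 := hk2 i
    rw [hci] at h1
    constructor <;> linarith
  have hcc : c ∈ cube d := hsub (mem_closedBall_self hs.le)
  have hcx : ‖c - x‖ ≤ d * (13 * s) := aux_norm_le _ _ (by positivity) fun i => hk3 i
  have hball : closedBall c s ⊆ closedBall (x : EuclideanSpace ℝ (Fin d)) (14 * d * s) := by
    apply closedBall_subset_closedBall'
    rw [dist_eq_norm]
    nlinarith
  have hcov := aux_local f c (f₀ ⟨c, hcc⟩) s a hs ha hsub (by
    intro y hy
    have hw : w y = (a / s) • ((y : EuclideanSpace ℝ (Fin d)) - c) := by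
      ext i
      change a * Real.arcsin (Real.sin ((y : EuclideanSpace ℝ (Fin d)) i / s)) =
        (a / s) * ((y : EuclideanSpace ℝ (Fin d)) i - c i)
      have e : (y : EuclideanSpace ℝ (Fin d)) i / s =
          ((y : EuclideanSpace ℝ (Fin d)) i - c i) / s + k i * (2 * Real.pi) := by
        rw [hci]; field_simp; ring
      have hu : |((y : EuclideanSpace ℝ (Fin d)) i - c i) / s| ≤ 1 := by
        rw [abs_div, abs_of_pos hs, div_le_one hs]
        exact hcoord y hy i
      have hp3 := Real.pi_gt_three
      rw [abs_le] at hu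
      rw [e, Real.sin_add_int_mul_two_pi, Real.arcsin_sin (by linarith) (by linarith)]
      ring
    have h1 : ‖f y - (f₀ + w) y‖ ≤ a / 8 := by
      rw [← dist_eq_norm]
      exact (ContinuousMap.dist_apply_le_dist y).trans (mem_ball.1 hf).le
    have h2 : ‖f₀ y - f₀ ⟨c, hcc⟩‖ ≤ a / 8 := by
      rw [← dist_eq_norm]
      refine (hδf ?_).le
      exact (mem_closedBall.1 hy).trans_lt hs2
    rw [← hw]
    calc ‖f y - (f₀ ⟨c, hcc⟩ + w y)‖ = ‖(f y - (f₀ + w) y) + (f₀ y - f₀ ⟨c, hcc⟩)‖ := by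
          congr 1; rw [ContinuousMap.add_apply]; abel
      _ ≤ a / 8 + a / 8 := (norm_add_le _ _).trans (add_le_add h1 h2)
      _ = a / 4 := by ring)
  calc (n : ENNReal) * volume (closedBall (x : EuclideanSpace ℝ (Fin d)) (14 * d * s))
      ≤ volume (closedBall (f₀ ⟨c, hcc⟩) (a / 4)) := by
        rw [Measure.addHaar_closedBall _ _ (by positivity), Measure.addHaar_closedBall _ _ (by positivity),
          ← mul_assoc, ← ENNReal.ofReal_natCast, ← ENNReal.ofReal_mul (by positivity)]
        gcongr
        rw [finrank_euclideanSpace_fin]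
        calc (n : ℝ) * (14 * d * s) ^ d ≤ (n + 1) ^ d * (14 * d * s) ^ d := by
              gcongr
              exact (by linarith : (n:ℝ) ≤ n + 1).trans (le_self_pow₀ (by linarith [n.cast_nonneg (α := ℝ)]) (by omega))
          _ = (14 * d * s * (n + 1)) ^ d := by rw [← mul_pow, mul_comm]
          _ ≤ (a / 4) ^ d := by gcongr
    _ ≤ volume (f '' ((↑) ⁻¹' closedBall (x : EuclideanSpace ℝ (Fin d)) (14 * d * s))) :=
        measure_mono (hcov.trans (image_mono (preimage_mono hball)))

/-- For every `d ≥ 1`, the set of continuous maps `f : [0,1]^d → ℝ^d` such that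
at every point `x` the ratio `λ(f(B(x,r) ∩ [0,1]^d)) / λ(B(x,r))` has limsup `∞`
as `r → 0⁺` is comeager. -/
theorem stmt9 (d : ℕ) (hd : 1 ≤ d) :
    {f : C(↥(cube d), EuclideanSpace ℝ (Fin d)) | ∀ x : ↥(cube d),
        Filter.limsup (fun r : ℝ =>
          volume (f '' ((↑) ⁻¹' closedBall (x : EuclideanSpace ℝ (Fin d)) r)) /
            volume (closedBall (x : EuclideanSpace ℝ (Fin d)) r)) (𝓝[>] 0) = ⊤} ∈
      residual C(↥(cube d), EuclideanSpace ℝ (Fin d)) := by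
  refine mem_of_superset (countable_iInter_mem.2 fun n => aux_residual d hd n) ?_
  intro f hf x
  rw [mem_iInter] at hf
  refine ENNReal.eq_top_of_forall_nnreal_le fun K => ?_
  refine le_limsup_of_frequently_le' ?_
  rw [(nhdsGT_basis (0:ℝ)).frequently_iff]
  intro η hη
  obtain ⟨N1, hN1⟩ := exists_nat_one_div_lt hη
  obtain ⟨N2, hN2⟩ := exists_nat_ge K
  obtain ⟨r, hr0, hr1, hr2⟩ := hf (max N1 N2) x
  refine ⟨r, ⟨hr0, ?_⟩, ?_⟩
  · refine hr1.trans_le (le_trans ?_ hN1.le)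
    gcongr
    exact le_max_left _ _
  · rw [ENNReal.le_div_iff_mul_le (Or.inl (measure_closedBall_pos _ _ hr0).ne')
      (Or.inl measure_closedBall_lt_top.ne)]
    refine le_trans ?_ hr2
    gcongr
    have : (K : ENNReal) ≤ (N2 : ENNReal) := by exact_mod_cast hN2
    refine this.trans ?_
    exact_mod_cast le_max_right _ _
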